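/- arXiv:1612.02133 — 6 statements merged into one kernel-verified Lean document; each statement's English description precedes it below -/
import Mathlib

section
/- Polarization identity for general conjugate forms over roots of unity: Let m ≥ 3 be an integer, let G : (ℂ^{2n})^d → ℂ be a conjugate super-symmetric ℂ-multilinear form with associated general conjugate form g, and let ξ₁, …, ξ_d be i.i.d. random variables, each uniform on Ω_m. Then for all x^1, …, x^d, y^1, …, y^d ∈ ℂ^n, E[ (∏_{i=1}^d conj(ξ_i)) · g( ∑_{k=1}^d ( conj(ξ_k)·conj(x^k) + ξ_k·y^k ) ) ] = d! · G((x^1; y^1), (x^2; y^2), …, (x^d; y^d)). -/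
open scoped BigOperators

/-- `omegaRoot m k = e^{2πik/m}`, so that for `k ∈ Fin m` these enumerate the
`m`-th roots of unity `Ω_m`; a uniform random variable on `Fin m` composed with
`omegaRoot m` is uniform on `Ω_m`. -/
noncomputable def omegaRoot (m k : ℕ) : ℂ :=
  Complex.exp (2 * Real.pi * Complex.I * k / m)

open scoped ComplexConjugate

theorem omegaRoot_eq_pow (m k : ℕ) :
    omegaRoot m k = Complex.exp (2 * Real.pi * Complex.I / m) ^ k := by
  rw [omegaRoot, ← Complex.exp_nat_mul]
  congr 1
  ring

theorem conj_mul_omegaRoot (m k : ℕ) : conj (omegaRoot m k) * omegaRoot m k = 1 := by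
  have h : (2 * Real.pi * Complex.I * k / m : ℂ) = ((2 * Real.pi * k / m : ℝ) : ℂ) * Complex.I := by
    push_cast
    ring
  rw [← Complex.normSq_eq_conj_mul_self, Complex.normSq_eq_norm_sq, omegaRoot, h,
    Complex.norm_exp_ofReal_mul_I]
  norm_num

/-- The `p`-th moment of a uniform root of unity vanishes when `0 < p < m`. -/
theorem sum_omegaRoot_pow {m p : ℕ} (hp : p ≠ 0) (hpm : p < m) :
    ∑ a : Fin m, omegaRoot m a ^ p = 0 := by
  have hζ := Complex.isPrimitiveRoot_exp m (by omega)
  set ζ := Complex.exp (2 * Real.pi * Complex.I / m)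
  have hne : ζ ^ p - 1 ≠ 0 := sub_ne_zero.mpr (hζ.pow_ne_one_of_pos_of_lt hp hpm)
  have hpow (a : ℕ) : omegaRoot m a ^ p = (ζ ^ p) ^ a := by
    rw [omegaRoot_eq_pow, pow_right_comm]
  simp only [hpow]
  rw [Fin.sum_univ_eq_sum_range (fun a => (ζ ^ p) ^ a)]
  apply (mul_eq_zero.mp _).resolve_right hne
  rw [geom_sum_mul, ← pow_mul, mul_comm, pow_mul, hζ.pow_eq_one, one_pow, sub_self]

theorem sum_conj_omegaRoot_pow {m p : ℕ} (hp : p ≠ 0) (hpm : p < m) :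
    ∑ a : Fin m, conj (omegaRoot m a) ^ p = 0 := by
  simpa using congrArg conj (sum_omegaRoot_pow hp hpm)

/-- `z` or its conjugate, according to a Boolean flag. -/
noncomputable def conjUnless (b : Bool) (z : ℂ) : ℂ := if b then z else conj z

theorem sum_prod_conj_mul_prod_conjUnless {d m : ℕ} (r : Fin d → Fin d × Bool) :
    ∑ κ : Fin d → Fin m, (∏ i, conj (omegaRoot m (κ i))) *
        ∏ j, conjUnless (r j).2 (omegaRoot m (κ (r j).1)) =
      ∏ i, ∑ a : Fin m, conj (omegaRoot m a) *
        ∏ j with (r j).1 = i, conjUnless (r j).2 (omegaRoot m a) := by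
  rw [Finset.prod_univ_sum, Fintype.piFinset_univ]
  refine Finset.sum_congr rfl fun κ _ => ?_
  rw [Finset.prod_mul_distrib,
    ← Finset.prod_fiberwise Finset.univ (fun j => (r j).1)
      (fun j => conjUnless (r j).2 (omegaRoot m (κ (r j).1)))]
  congr 1
  refine Finset.prod_congr rfl fun i _ => Finset.prod_congr rfl fun j hj => ?_
  rw [(Finset.mem_filter.mp hj).2]

theorem sum_prod_conj_mul_prod_perm {d m : ℕ} (e : Equiv.Perm (Fin d)) :
    ∑ κ : Fin d → Fin m, (∏ i, conj (omegaRoot m (κ i))) *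
        ∏ j, conjUnless true (omegaRoot m (κ (e j))) = (m : ℂ) ^ d := by
  have h (κ : Fin d → Fin m) : (∏ i, conj (omegaRoot m (κ i))) *
      ∏ j, conjUnless true (omegaRoot m (κ (e j))) = 1 := by
    simp only [conjUnless, if_true]
    rw [Equiv.prod_comp e (fun i => omegaRoot m (κ i)), ← Finset.prod_mul_distrib]
    simp only [conj_mul_omegaRoot, Finset.prod_const_one]
  simp [h]

theorem sum_prod_conj_mul_prod_eq_zero {d m : ℕ} (hm : 3 ≤ m) (r : Fin d → Fin d × Bool)
    (hr : r ∉ Set.range fun (e : Equiv.Perm (Fin d)) j => (e j, true)) :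
    ∑ κ : Fin d → Fin m, (∏ i, conj (omegaRoot m (κ i))) *
        ∏ j, conjUnless (r j).2 (omegaRoot m (κ (r j).1)) = 0 := by
  rw [sum_prod_conj_mul_prod_conjUnless]
  by_cases hs : Function.Surjective fun j => (r j).1
  · have hb : Function.Bijective fun j => (r j).1 := Finite.surjective_iff_bijective.mp hs
    obtain ⟨j, hj⟩ : ∃ j, (r j).2 = false := by
      by_contra! h
      refine hr ⟨Equiv.ofBijective _ hb, funext fun j => Prod.ext rfl ?_⟩
      simpa using (h j).symm
    refine Finset.prod_eq_zero (Finset.mem_univ (r j).1) ?_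
    have hfib : ({k | (r k).1 = (r j).1} : Finset (Fin d)) = {j} := by
      ext k
      simpa using hb.injective.eq_iff (a := k) (b := j)
    simpa [hfib, conjUnless, hj, ← pow_two] using
      sum_conj_omegaRoot_pow two_ne_zero (by omega : 2 < m)
  · obtain ⟨i, hi⟩ := not_forall.mp hs
    refine Finset.prod_eq_zero (Finset.mem_univ i) ?_
    have hfib : ({k | (r k).1 = i} : Finset (Fin d)) = ∅ :=
      Finset.filter_eq_empty_iff.mpr fun k _ hk => hi ⟨k, hk⟩
    simpa [hfib] using sum_conj_omegaRoot_pow one_ne_zero (by omega : 1 < m)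

/-- Polarization of a symmetric multilinear form along vectors `V (k, b)`, where `V (k, true)` is
weighted by a root of unity and `V (k, false)` by its conjugate. -/
theorem MultilinearMap.sum_omegaRoot_polarization {d m : ℕ} (hm : 3 ≤ m)
    {E : Type*} [AddCommGroup E] [Module ℂ E] (G : MultilinearMap ℂ (fun _ : Fin d => E) ℂ)
    (hsymm : ∀ (v : Fin d → E) (e : Equiv.Perm (Fin d)), G (fun k => v (e k)) = G v)
    (V : Fin d × Bool → E) :
    ∑ κ : Fin d → Fin m, (∏ i, conj (omegaRoot m (κ i))) *
        G (fun _ => ∑ p : Fin d × Bool, conjUnless p.2 (omegaRoot m (κ p.1)) • V p) =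
      (m : ℂ) ^ d * (d.factorial * G fun k => V (k, true)) := by
  simp only [MultilinearMap.map_sum, MultilinearMap.map_smul_univ, smul_eq_mul, Finset.mul_sum,
    ← mul_assoc]
  rw [Finset.sum_comm]
  simp only [← Finset.sum_mul]
  rw [← Fintype.sum_of_injective (fun (e : Equiv.Perm (Fin d)) j => (e j, true)) ?_
    (fun _ => (m : ℂ) ^ d * G fun k => V (k, true)) _ ?_ ?_]
  · simp [Fintype.card_perm]
    ring
  · intro e e' h
    ext j
    simpa using congrArg (fun r => (r j).1.val) h
  · intro r hr
    rw [sum_prod_conj_mul_prod_eq_zero hm r hr, zero_mul]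
  · intro e
    simp only [sum_prod_conj_mul_prod_perm, hsymm (fun k => V (k, true)) e]

/-- Polarization identity for general conjugate forms over the `m`-th roots of unity.
The expectation over i.i.d. `ξ₁,…,ξ_d` uniform on `Ω_m` is written as the average
over all `κ : Fin d → Fin m` of the corresponding values, with `ξ_i = omegaRoot m (κ i)`.
`ℂ^{2n}` is encoded as `Fin n ⊕ Fin n → ℂ`, stacking `(x; y) = Sum.elim x y`. -/
theorem polarization_identity_roots_of_unity
    (n d m : ℕ) (hn : 1 ≤ n) (hd : 1 ≤ d) (hm : 3 ≤ m)
    (G : MultilinearMap ℂ (fun _ : Fin d => (Fin n ⊕ Fin n → ℂ)) ℂ)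
    (hsymm : ∀ (v : Fin d → (Fin n ⊕ Fin n → ℂ)) (e : Equiv.Perm (Fin d)),
      G (fun k => v (e k)) = G v)
    (hconj : ∀ v : Fin d → (Fin n ⊕ Fin n → ℂ),
      G (fun k => fun j => starRingEnd ℂ (v k (Sum.swap j))) = starRingEnd ℂ (G v))
    (x y : Fin d → (Fin n → ℂ)) :
    ((m : ℂ) ^ d)⁻¹ *
      ∑ κ : Fin d → Fin m,
        (∏ i, starRingEnd ℂ (omegaRoot m (κ i))) *
          G (fun _ => Sum.elim
              (fun j => starRingEnd ℂ
                (∑ k, (starRingEnd ℂ (omegaRoot m (κ k)) * starRingEnd ℂ (x k j)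
                    + omegaRoot m (κ k) * y k j)))
              (fun j => ∑ k, (starRingEnd ℂ (omegaRoot m (κ k)) * starRingEnd ℂ (x k j)
                    + omegaRoot m (κ k) * y k j)))
      = (d.factorial : ℂ) * G (fun k => Sum.elim (x k) (y k)) := by
  have harg (κ : Fin d → Fin m) :
      (Sum.elim
        (fun j => conj (∑ k, (conj (omegaRoot m (κ k)) * conj (x k j) + omegaRoot m (κ k) * y k j)))
        (fun j => ∑ k, (conj (omegaRoot m (κ k)) * conj (x k j) + omegaRoot m (κ k) * y k j)) :
          Fin n ⊕ Fin n → ℂ) =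
      ∑ p : Fin d × Bool, conjUnless p.2 (omegaRoot m (κ p.1)) •
        (if p.2 then Sum.elim (x p.1) (y p.1)
          else Sum.elim (fun j => conj (y p.1 j)) (fun j => conj (x p.1 j))) := by
    rw [Fintype.sum_prod_type]
    ext (j | j)
    · simp [conjUnless]
    · simp [conjUnless, add_comm]
  have hm0 : (m : ℂ) ≠ 0 := Nat.cast_ne_zero.mpr (by omega)
  simp only [harg]
  rw [G.sum_omegaRoot_polarization hm hsymm fun p => if p.2 then Sum.elim (x p.1) (y p.1)
      else Sum.elim (fun j => conj (y p.1 j)) (fun j => conj (x p.1 j)),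
    inv_mul_cancel_left₀ (pow_ne_zero d hm0)]
  simp
end

section
/- Polarization identity for general conjugate forms over the unit circle: Let G : (ℂ^{2n})^d → ℂ be a conjugate super-symmetric ℂ-multilinear form with associated general conjugate form g, and let ξ₁, …, ξ_d be i.i.d. random variables, each uniform on the complex unit circle Ω_∞. Then for all x^1, …, x^d, y^1, …, y^d ∈ ℂ^n, E[ (∏_{i=1}^d conj(ξ_i)) · g( ∑_{k=1}^d ( conj(ξ_k)·conj(x^k) + ξ_k·y^k ) ) ] = d! · G((x^1; y^1), (x^2; y^2), …, (x^d; y^d)). -/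
open scoped BigOperators

open MeasureTheory in
theorem integral_Ico_exp_int_mul_I (N : ℤ) :
    ∫ t : ℝ in Set.Ico 0 (2 * Real.pi), Complex.exp (N * (t * Complex.I))
      = if N = 0 then ((2 * Real.pi : ℝ) : ℂ) else 0 := by
  rw [integral_Ico_eq_integral_Ioc, ← intervalIntegral.integral_of_le (by positivity)]
  split_ifs with h
  · simp [h]
  · have hc : (N * Complex.I : ℂ) ≠ 0 := mul_ne_zero (by exact_mod_cast h) Complex.I_ne_zero
    have := integral_exp_mul_complex (a := 0) (b := 2 * Real.pi) hc
    have h2 : Complex.exp (N * Complex.I * ((2 * Real.pi : ℝ) : ℂ)) = 1 := by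
      rw [← Complex.exp_int_mul_two_pi_mul_I N]
      congr 1
      push_cast
      ring
    rw [h2] at this
    simp only [Complex.ofReal_zero, mul_zero, Complex.exp_zero, sub_self, zero_div] at this
    rw [← this]
    congr 1
    ext t
    ring_nf

open MeasureTheory in
theorem integral_pi_Ico_prod_exp_int_mul_I {d : ℕ} (N : Fin d → ℤ) :
    ∫ θ : Fin d → ℝ in Set.univ.pi (fun _ : Fin d => Set.Ico 0 (2 * Real.pi)),
        ∏ i, Complex.exp (N i * (θ i * Complex.I))
      = if ∀ i, N i = 0 then (((2 * Real.pi) ^ d : ℝ) : ℂ) else 0 := by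
  rw [volume_pi, Measure.restrict_pi_pi,
    integral_fintype_prod_eq_prod (fun i (t : ℝ) => Complex.exp (N i * (t * Complex.I)))]
  simp_rw [integral_Ico_exp_int_mul_I]
  split_ifs with h
  · simp [h]
  · obtain ⟨i, hi⟩ := not_forall.mp h
    exact Finset.prod_eq_zero (Finset.mem_univ i) (if_neg hi)

/-- The sign of a choice between `ξ` (`true`) and its conjugate (`false`). -/
def boolSign (b : Bool) : ℤ := if b then 1 else -1

/-- The exponent of `ξ i` in the monomial selected by `r`, after multiplication by `conj (ξ i)`. -/
def netExponent {d : ℕ} (r : Fin d → Fin d × Bool) (i : Fin d) : ℤ :=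
  (∑ m, if (r m).1 = i then boolSign (r m).2 else 0) - 1

theorem netExponent_perm {d : ℕ} (σ : Equiv.Perm (Fin d)) (i : Fin d) :
    netExponent (fun m => (σ m, true)) i = 0 := by
  have h : ∀ m, (σ m = i) ↔ (m = σ.symm i) := fun m => by rw [Equiv.eq_symm_apply]
  simp [netExponent, boolSign, h]

theorem exists_perm_of_netExponent_eq_zero {d : ℕ} (r : Fin d → Fin d × Bool)
    (h : ∀ i, netExponent r i = 0) :
    ∃ σ : Equiv.Perm (Fin d), (fun m => (σ m, true)) = r := by
  have hi : ∀ i, (∑ m, if (r m).1 = i then boolSign (r m).2 else 0) = 1 := fun i =>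
    sub_eq_zero.mp (h i)
  have htot : ∑ m, boolSign (r m).2 = ∑ _m : Fin d, (1 : ℤ) := by
    rw [← Finset.sum_congr rfl (fun i _ => hi i), Finset.sum_comm]
    simp
  have hle : ∀ m ∈ Finset.univ, boolSign (r m).2 ≤ 1 := fun m _ => by
    cases (r m).2 <;> simp [boolSign]
  have hb : ∀ m, (r m).2 = true := fun m => by
    have := (Finset.sum_eq_sum_iff_of_le hle).mp htot m (Finset.mem_univ m)
    cases hm : (r m).2
    · simp [hm, boolSign] at this
    · rfl
  have hsurj : Function.Surjective fun m => (r m).1 := fun i => by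
    by_contra! hne
    have := hi i
    simp [hne] at this
  refine ⟨Equiv.ofBijective _ (Finite.injective_iff_bijective.mp
    (Finite.injective_iff_surjective.mpr hsurj)), ?_⟩
  ext m : 1
  exact Prod.ext rfl (hb m).symm

theorem prod_conj_exp_mul_prod_exp {d : ℕ} (r : Fin d → Fin d × Bool) (θ : Fin d → ℝ) :
    (∏ i, starRingEnd ℂ (Complex.exp (θ i * Complex.I))) *
        ∏ m, Complex.exp (boolSign (r m).2 * (θ (r m).1 * Complex.I))
      = ∏ i, Complex.exp (netExponent r i * (θ i * Complex.I)) := by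
  simp only [← Complex.exp_conj, ← Complex.exp_sum, ← Complex.exp_add]
  congr 1
  simp only [netExponent, map_mul, Complex.conj_ofReal, Complex.conj_I, Int.cast_sub, Int.cast_sum,
    Int.cast_ite, Int.cast_zero, Int.cast_one, sub_mul, Finset.sum_sub_distrib, Finset.sum_mul,
    ite_mul, zero_mul, one_mul]
  rw [Finset.sum_comm]
  simp only [Finset.sum_ite_eq, Finset.mem_univ, if_true, mul_neg, Finset.sum_neg_distrib]
  ring

/-- The vector multiplying `ξ k` (`true`) or its conjugate (`false`) in the stacked argument. -/
noncomputable def stackedVector {n d : ℕ} (x y : Fin d → Fin n → ℂ) (p : Fin d × Bool) :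
    Fin n ⊕ Fin n → ℂ :=
  if p.2 then Sum.elim (x p.1) (y p.1)
  else Sum.elim (fun j => starRingEnd ℂ (y p.1 j)) (fun j => starRingEnd ℂ (x p.1 j))

theorem stacked_eq_sum {n d : ℕ} (x y : Fin d → Fin n → ℂ) (θ : Fin d → ℝ) :
    Sum.elim
        (fun j => starRingEnd ℂ
          (∑ k, (starRingEnd ℂ (Complex.exp (θ k * Complex.I)) * starRingEnd ℂ (x k j)
              + Complex.exp (θ k * Complex.I) * y k j)))
        (fun j => ∑ k, (starRingEnd ℂ (Complex.exp (θ k * Complex.I)) * starRingEnd ℂ (x k j)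
              + Complex.exp (θ k * Complex.I) * y k j))
      = ∑ p : Fin d × Bool,
          Complex.exp (boolSign p.2 * (θ p.1 * Complex.I)) • stackedVector x y p := by
  ext (j | j) <;>
  · simp only [Fintype.sum_prod_type, Finset.sum_apply, Sum.elim_inl, Sum.elim_inr, map_sum]
    refine Finset.sum_congr rfl fun k _ => ?_
    simp [stackedVector, boolSign, ← Complex.exp_conj, add_comm]

/-- Polarization identity for general conjugate forms over the complex unit circle.
The i.i.d. random variables `ξ₁,…,ξ_d`, each uniform on `Ω_∞ = {z : |z| = 1}`, are
realized as `ξ_k = exp(θ_k i)` with `θ = (θ₁,…,θ_d)` uniform on `[0,2π)^d`; the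
expectation is the integral over `[0,2π)^d` normalized by `(2π)^d`.
`ℂ^{2n}` is encoded as `Fin n ⊕ Fin n → ℂ`, stacking `(x; y) = Sum.elim x y`. -/
theorem polarization_identity_unit_circle
    (n d : ℕ) (hn : 1 ≤ n) (hd : 1 ≤ d)
    (G : MultilinearMap ℂ (fun _ : Fin d => (Fin n ⊕ Fin n → ℂ)) ℂ)
    (hsymm : ∀ (v : Fin d → (Fin n ⊕ Fin n → ℂ)) (e : Equiv.Perm (Fin d)),
      G (fun k => v (e k)) = G v)
    (hconj : ∀ v : Fin d → (Fin n ⊕ Fin n → ℂ),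
      G (fun k => fun j => starRingEnd ℂ (v k (Sum.swap j))) = starRingEnd ℂ (G v))
    (x y : Fin d → (Fin n → ℂ)) :
    ((((2 * Real.pi) ^ d : ℝ)) : ℂ)⁻¹ *
      ∫ θ : Fin d → ℝ in Set.univ.pi (fun _ : Fin d => Set.Ico 0 (2 * Real.pi)),
        (∏ i, starRingEnd ℂ (Complex.exp (θ i * Complex.I))) *
          G (fun _ => Sum.elim
              (fun j => starRingEnd ℂ
                (∑ k, (starRingEnd ℂ (Complex.exp (θ k * Complex.I)) * starRingEnd ℂ (x k j)
                    + Complex.exp (θ k * Complex.I) * y k j)))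
              (fun j => ∑ k, (starRingEnd ℂ (Complex.exp (θ k * Complex.I)) * starRingEnd ℂ (x k j)
                    + Complex.exp (θ k * Complex.I) * y k j)))
      = (d.factorial : ℂ) * G (fun k => Sum.elim (x k) (y k)) := by
  have hexp (θ : Fin d → ℝ) :
      (∏ i, starRingEnd ℂ (Complex.exp (θ i * Complex.I))) *
          G (fun _ => ∑ p : Fin d × Bool,
            Complex.exp (boolSign p.2 * (θ p.1 * Complex.I)) • stackedVector x y p)
        = ∑ r : Fin d → Fin d × Bool, (∏ i, Complex.exp (netExponent r i * (θ i * Complex.I))) *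
            G (fun m => stackedVector x y (r m)) := by
    rw [MultilinearMap.map_sum, Finset.mul_sum]
    refine Finset.sum_congr rfl fun r _ => ?_
    rw [MultilinearMap.map_smul_univ, smul_eq_mul, ← mul_assoc, prod_conj_exp_mul_prod_exp]
  simp_rw [stacked_eq_sum, hexp]
  rw [MeasureTheory.integral_finsetSum]
  swap
  · intro r _
    refine MeasureTheory.IntegrableOn.mono_set ?_
      (Set.pi_mono fun _ _ => Set.Ico_subset_Icc_self)
    refine ContinuousOn.integrableOn_compact (isCompact_univ_pi fun _ => isCompact_Icc) ?_
    fun_prop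
  simp_rw [MeasureTheory.integral_mul_const, integral_pi_Ico_prod_exp_int_mul_I]
  have hπ : (((2 * Real.pi) ^ d : ℝ) : ℂ) ≠ 0 := by
    exact_mod_cast pow_ne_zero d Real.two_pi_pos.ne'
  rw [← Finset.sum_of_injOn (s := Finset.univ)
    (f := fun _ : Equiv.Perm (Fin d) =>
      (((2 * Real.pi) ^ d : ℝ) : ℂ) * G (fun k => Sum.elim (x k) (y k)))
    (fun σ m => (σ m, true))]
  · rw [Finset.sum_const, Finset.card_univ, Fintype.card_perm, Fintype.card_fin, nsmul_eq_mul]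
    field_simp
  · intro σ _ τ _ h
    ext m : 1
    exact congrArg Prod.fst (congrFun h m)
  · exact fun _ _ => Finset.mem_coe.mpr (Finset.mem_univ _)
  · intro r _ hr
    rw [if_neg, zero_mul]
    intro h
    obtain ⟨σ, hσ⟩ := exists_perm_of_netExponent_eq_zero r h
    exact hr ⟨σ, Finset.mem_coe.mpr (Finset.mem_univ σ), hσ⟩
  · intro σ _
    rw [if_pos (netExponent_perm σ)]
    congr 1
    exact (hsymm (fun k => Sum.elim (x k) (y k)) σ).symm
end

section
/- Symmetrization bound for random linear forms over roots of unity: Let m ≥ 3 be an integer, let ξ₁, …, ξ_n be i.i.d. random variables each uniform on Ω_m, let a ∈ ℂ^n, and set η = Re(∑_{i=1}^n a_i ξ_i). Then for every t ≥ 0, Prob{ η² ≥ t² } ≤ 3 · Prob{ η ≥ t/2 }. -/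
open scoped BigOperators

theorem omegaRoot_add (m j k : ℕ) : omegaRoot m (j + k) = omegaRoot m j * omegaRoot m k := by
  simp only [omegaRoot, ← Complex.exp_add]
  congr 1
  push_cast
  ring

theorem omegaRoot_mod {m : ℕ} (hm : m ≠ 0) (k : ℕ) : omegaRoot m (k % m) = omegaRoot m k := by
  have hperiod : omegaRoot m (m * (k / m)) = 1 := by
    rw [omegaRoot, Complex.exp_eq_one_iff]
    refine ⟨(k / m : ℕ), ?_⟩
    have : (m : ℂ) ≠ 0 := by exact_mod_cast hm
    rw [Int.cast_natCast, Nat.cast_mul]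
    field_simp
  conv_rhs => rw [← Nat.mod_add_div k m, omegaRoot_add, hperiod, mul_one]

theorem omegaRoot_val_add {m : ℕ} [NeZero m] (j k : Fin m) :
    omegaRoot m (j + k : Fin m) = omegaRoot m j * omegaRoot m k := by
  rw [Fin.val_add, omegaRoot_mod (NeZero.ne m), omegaRoot_add]

theorem omegaRoot_eq_exp_mul_I (m k : ℕ) :
    omegaRoot m k = Complex.exp ((2 * Real.pi * k / m : ℝ) * Complex.I) := by
  rw [omegaRoot]
  congr 1
  push_cast
  ring

theorem conj_omegaRoot_mul_self (m k : ℕ) :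
    (starRingEnd ℂ) (omegaRoot m k) * omegaRoot m k = 1 := by
  rw [mul_comm, Complex.mul_conj, Complex.normSq_eq_norm_sq, omegaRoot_eq_exp_mul_I,
    Complex.norm_exp_ofReal_mul_I]
  simp

theorem re_omegaRoot_half_le {m : ℕ} (hm : 3 ≤ m) : (omegaRoot m (m / 2)).re ≤ -(1 / 2) := by
  rw [omegaRoot_eq_exp_mul_I, Complex.exp_ofReal_mul_I_re]
  have hpi := Real.pi_pos
  have hm0 : (0 : ℝ) < m := by positivity
  have hlow : (m : ℝ) ≤ 3 * (m / 2 : ℕ) := by exact_mod_cast (by omega : m ≤ 3 * (m / 2))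
  have hupp : (2 : ℝ) * (m / 2 : ℕ) ≤ m := by exact_mod_cast (by omega : 2 * (m / 2) ≤ m)
  have hcos : Real.cos (2 * Real.pi / 3) = -(1 / 2) := by
    rw [show 2 * Real.pi / 3 = Real.pi - Real.pi / 3 by ring, Real.cos_pi_sub,
      Real.cos_pi_div_three]
  rw [← hcos]
  apply Real.cos_le_cos_of_nonneg_of_le_pi (by positivity)
  · rw [div_le_iff₀ hm0]
    nlinarith
  · rw [le_div_iff₀ hm0]
    nlinarith

/-- Since `Re(zS) + Re(conj z * S) = 2 Re z * Re S`, if `Re z ≤ -1/2` then one of two opposite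
rotations of a number with very negative real part has large real part. -/
theorem half_le_re_mul_or_half_le_re_conj_mul {z S : ℂ} {t : ℝ} (ht : 0 ≤ t)
    (hz : z.re ≤ -(1 / 2)) (hS : S.re ≤ -t) :
    t / 2 ≤ (z * S).re ∨ t / 2 ≤ ((starRingEnd ℂ) z * S).re := by
  by_contra! h
  simp only [Complex.mul_re, Complex.conj_re, Complex.conj_im] at h
  nlinarith [h.1, h.2]

theorem ncard_le_two_mul_of_equiv {α : Type*} [Finite α] (A B : Set α) (e f : α ≃ α)
    (h : ∀ x ∈ A, e x ∈ B ∨ f x ∈ B) : A.ncard ≤ 2 * B.ncard := by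
  have hsub : A ⊆ e ⁻¹' B ∪ f ⁻¹' B := h
  have he : (e ⁻¹' B).ncard = B.ncard :=
    Set.ncard_preimage_of_injective_subset_range e.injective (by simp)
  have hf : (f ⁻¹' B).ncard = B.ncard :=
    Set.ncard_preimage_of_injective_subset_range f.injective (by simp)
  have := (Set.ncard_le_ncard hsub (Set.toFinite _)).trans (Set.ncard_union_le _ _)
  omega

/-- Symmetrization bound: for i.i.d. `ξ₁,…,ξ_n` uniform on `Ω_m` (`m ≥ 3`),
`η = Re(∑ aᵢξᵢ)` and `t ≥ 0`, `Prob{η² ≥ t²} ≤ 3·Prob{η ≥ t/2}`.  Probabilities are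
counting measures over `κ : Fin n → Fin m` (with `ξᵢ = omegaRoot m (κ i)`) divided
by `m^n`. -/
theorem symmetrization_bound_roots_of_unity
    (n m : ℕ) (hm : 3 ≤ m) (a : Fin n → ℂ) (t : ℝ) (ht : 0 ≤ t) :
    (Nat.card {κ : Fin n → Fin m //
        t ^ 2 ≤ ((∑ i, a i * omegaRoot m (κ i)).re) ^ 2} : ℝ) / (m : ℝ) ^ n
      ≤ 3 * ((Nat.card {κ : Fin n → Fin m //
          t / 2 ≤ (∑ i, a i * omegaRoot m (κ i)).re} : ℝ) / (m : ℝ) ^ n) := by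
  have : NeZero m := ⟨by omega⟩
  let S : (Fin n → Fin m) → ℂ := fun κ => ∑ i, a i * omegaRoot m (κ i)
  let B : Set (Fin n → Fin m) := {κ | t / 2 ≤ (S κ).re}
  let j : Fin m := ⟨m / 2, by omega⟩
  have hadd (κ : Fin n → Fin m) : S (κ + fun _ => j) = omegaRoot m j * S κ := by
    simp only [S, Pi.add_apply, omegaRoot_val_add, Finset.mul_sum]
    exact Finset.sum_congr rfl fun i _ => by ring
  have hsub (κ : Fin n → Fin m) :
      S (κ - fun _ => j) = (starRingEnd ℂ) (omegaRoot m j) * S κ := by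
    have h := hadd (κ - fun _ => j)
    rw [sub_add_cancel] at h
    rw [h, ← mul_assoc, conj_omegaRoot_mul_self, one_mul]
  have hneg : {κ | (S κ).re ≤ -t}.ncard ≤ 2 * B.ncard := by
    refine ncard_le_two_mul_of_equiv _ _ (Equiv.addRight fun _ => j)
      (Equiv.subRight fun _ => j) fun κ hκ => ?_
    simp only [B, Set.mem_ofPred_eq, Equiv.coe_addRight, Equiv.subRight_apply, hadd, hsub]
    exact half_le_re_mul_or_half_le_re_conj_mul ht (re_omegaRoot_half_le hm) hκ
  have hcover : {κ | t ^ 2 ≤ (S κ).re ^ 2} ⊆ B ∪ {κ | (S κ).re ≤ -t} := by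
    intro κ hκ
    have habs : t ≤ |(S κ).re| := by
      rw [← abs_of_nonneg ht]
      exact sq_le_sq.mp (Set.mem_ofPred.mp hκ)
    rcases le_abs.mp habs with h | h
    · left
      change t / 2 ≤ (S κ).re
      linarith
    · right
      change (S κ).re ≤ -t
      linarith
  have hcard : {κ | t ^ 2 ≤ (S κ).re ^ 2}.ncard ≤ 3 * B.ncard := by
    have := (Set.ncard_le_ncard hcover (Set.toFinite _)).trans (Set.ncard_union_le _ _)
    omega
  rw [← mul_div_assoc]
  gcongr
  exact_mod_cast hcard
end

section
/- Rounding square-free functions from the polytope conv(Ω_m) to its vertices (Proposition 6.1(i)): Let m ≥ 3 be an integer and let g : ℂ^n → ℝ be square-free. If x ∈ ℂ^n satisfies x_i ∈ convexHull(Ω_m) for every i = 1, …, n, then there exist y, z ∈ Ω_m^n (i.e., all entries of y and z are m-th roots of unity) such that g(y) ≤ g(x) ≤ g(z). -/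
open scoped BigOperators

/-- A function that is convex in each coordinate separately can be rounded upwards from a product
of convex hulls to the generating set. -/
theorem exists_forall_mem_le_of_convexOn_update {ι E : Type*} [Fintype ι] [DecidableEq ι]
    [AddCommGroup E] [Module ℝ E] {S : Set E} {g : (ι → E) → ℝ}
    (hg : ∀ i x, ConvexOn ℝ Set.univ fun w => g (Function.update x i w))
    {x : ι → E} (hx : ∀ i, x i ∈ convexHull ℝ S) :
    ∃ z : ι → E, (∀ i, z i ∈ S) ∧ g x ≤ g z := by
  suffices h : ∀ s : Finset ι, ∃ z : ι → E,
      (∀ i ∈ s, z i ∈ S) ∧ (∀ i ∉ s, z i = x i) ∧ g x ≤ g z by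
    obtain ⟨z, hz, -, hle⟩ := h Finset.univ
    exact ⟨z, fun i => hz i (Finset.mem_univ i), hle⟩
  intro s
  induction s using Finset.induction_on with
  | empty => exact ⟨x, by simp, by simp, le_rfl⟩
  | insert a s ha ih =>
    obtain ⟨z, hzS, hzx, hle⟩ := ih
    obtain ⟨w, hw, hzw⟩ := (hg a z).exists_ge_of_mem_convexHull (Set.subset_univ S) (hx a)
    rw [← hzx a ha, Function.update_eq_self] at hzw
    refine ⟨Function.update z a w, fun i hi => ?_, fun i hi => ?_, hle.trans hzw⟩
    · obtain rfl | hia := eq_or_ne i a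
      · simpa using hw
      · simpa [hia] using hzS i (Finset.mem_of_mem_insert_of_ne hi hia)
    · rw [Finset.mem_insert, not_or] at hi
      simpa [hi.1] using hzx i hi.2

/-- Rounding square-free functions from `conv(Ω_m)` to its vertices
(Proposition 6.1(i)): if `g : ℂ^n → ℝ` is square-free — i.e. in each coordinate
separately it is real-affine (an `ℝ`-linear functional on `ℂ ≅ ℝ²` plus a constant) —
and `x ∈ ℂ^n` has every entry in the convex hull of the `m`-th roots of unity
`Ω_m = {z : z^m = 1}`, then there are `y, z` with all entries in `Ω_m` such that
`g y ≤ g x ≤ g z`. -/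
theorem rounding_square_free
    (n m : ℕ) (hm : 3 ≤ m) (g : (Fin n → ℂ) → ℝ)
    (hsf : ∀ (i : Fin n) (x : Fin n → ℂ), ∃ (L : ℂ →ₗ[ℝ] ℝ) (c : ℝ),
      ∀ w : ℂ, g (Function.update x i w) = L w + c)
    (x : Fin n → ℂ) (hx : ∀ i, x i ∈ convexHull ℝ {w : ℂ | w ^ m = 1}) :
    ∃ y z : Fin n → ℂ,
      (∀ i, (y i) ^ m = 1) ∧ (∀ i, (z i) ^ m = 1) ∧ g y ≤ g x ∧ g x ≤ g z := by
  obtain ⟨z, hz, hxz⟩ := exists_forall_mem_le_of_convexOn_update (g := g) (fun i x => by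
    obtain ⟨L, c, h⟩ := hsf i x
    simp only [h]
    exact (L.convexOn convex_univ).add_const c) hx
  obtain ⟨y, hy, hxy⟩ := exists_forall_mem_le_of_convexOn_update (g := -g) (fun i x => by
    obtain ⟨L, c, h⟩ := hsf i x
    simp only [Pi.neg_apply, h]
    exact ((L.concaveOn convex_univ).add_const c).neg) hx
  exact ⟨y, z, hy, hz, neg_le_neg_iff.mp hxy, hxz⟩
end

section
/- Deterministic core of Theorem 6.3 (convex conjugate form versus its multilinear relaxation over roots of unity): Let m ≥ 3 be an integer, let d ≥ 2, let G : (ℂ^{2n})^d → ℂ be a conjugate super-symmetric ℂ-multilinear form whose associated general conjugate form g : ℂ^n → ℝ is convex (as a function on ℝ^{2n}). Then for all z^1, …, z^d ∈ Ω_m^{2n} (vectors in ℂ^{2n} with all entries m-th roots of unity), max{ g(x) : x ∈ Ω_m^n } ≥ (d! / (2d)^d) · Re G(z^1, …, z^d). -/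
open scoped BigOperators

/-- The powers of a nontrivial `m`-th root of unity sum to zero. -/
theorem sum_pow_eq_zero_of_pow_eq_one {K : Type*} [Field K] {m : ℕ} {x : K}
    (hx : x ^ m = 1) (hx1 : x ≠ 1) : ∑ t : Fin m, x ^ (t : ℕ) = 0 := by
  rw [Fin.sum_univ_eq_sum_range (fun t => x ^ t) m]
  have h := geom_sum_mul x m
  rw [hx, sub_self] at h
  exact (mul_eq_zero.mp h).resolve_right (sub_ne_zero.mpr hx1)

/-- Averaging `∏ₖ ωₖ · ∏ⱼ uⱼ` over independent `m`-th roots of unity gives zero as soon as the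
word `r` does not use every index. -/
theorem sum_rootsOfUnity_word_eq_zero_of_not_surjective {K : Type*} [Field K] {d m : ℕ}
    {ω : K} (hω : ω ^ m = 1) (hω1 : ω ≠ 1) (u : Bool → K) (r : Fin d → Fin d × Bool)
    (hr : ¬ Function.Surjective fun j => (r j).1) :
    ∑ s : Fin d → Fin m,
      (∏ k, ω ^ (s k : ℕ)) * ∏ j, u (r j).2 ^ (s (r j).1 : ℕ) = 0 := by
  have hprod : ∀ s : Fin d → Fin m,
      (∏ k, ω ^ (s k : ℕ)) * ∏ j, u (r j).2 ^ (s (r j).1 : ℕ)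
        = ∏ k, (ω ^ (s k : ℕ) * ∏ j with (r j).1 = k, u (r j).2 ^ (s k : ℕ)) := by
    intro s
    rw [Finset.prod_mul_distrib, ← Finset.prod_fiberwise Finset.univ (fun j => (r j).1)
      (fun j => u (r j).2 ^ (s (r j).1 : ℕ))]
    congr 1
    refine Finset.prod_congr rfl fun k _ => Finset.prod_congr rfl fun j hj => ?_
    rw [(Finset.mem_filter.mp hj).2]
  simp_rw [hprod]
  rw [← Fintype.prod_sum (fun k (t : Fin m) =>
    ω ^ (t : ℕ) * ∏ j with (r j).1 = k, u (r j).2 ^ (t : ℕ))]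
  obtain ⟨k, hk⟩ := not_forall.mp hr
  refine Finset.prod_eq_zero (Finset.mem_univ k) ?_
  have hempty : (Finset.univ.filter fun j => (r j).1 = k) = ∅ :=
    Finset.filter_eq_empty_iff.mpr fun j _ hj => hk ⟨j, hj⟩
  simp only [hempty, Finset.prod_empty, mul_one]
  exact sum_pow_eq_zero_of_pow_eq_one hω hω1

/-- The average of a word whose indices form a permutation. -/
theorem sum_rootsOfUnity_word_of_perm {K : Type*} [Field K] {d m : ℕ} (ω : K) (u : Bool → K)
    (e : Equiv.Perm (Fin d)) (b : Fin d → Bool) :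
    ∑ s : Fin d → Fin m, (∏ k, ω ^ (s k : ℕ)) * ∏ j, u (b j) ^ (s (e j) : ℕ)
      = ∏ j, ∑ t : Fin m, (ω * u (b j)) ^ (t : ℕ) := by
  have hprod : ∀ s : Fin d → Fin m,
      (∏ k, ω ^ (s k : ℕ)) * ∏ j, u (b j) ^ (s (e j) : ℕ)
        = ∏ k, (ω * u (b (e.symm k))) ^ (s k : ℕ) := by
    intro s
    rw [← Equiv.prod_comp e.symm (fun j => u (b j) ^ (s (e j) : ℕ)), ← Finset.prod_mul_distrib]
    simp [mul_pow]
  simp_rw [hprod]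
  rw [← Fintype.prod_sum (fun k (t : Fin m) => (ω * u (b (e.symm k))) ^ (t : ℕ))]
  exact Equiv.prod_comp e.symm (fun j => ∑ t : Fin m, (ω * u (b j)) ^ (t : ℕ))

/-- Polarization over `m`-th roots of unity, `m ≥ 3`, with each vector `V k true` perturbed by
a vector `V k false` weighted by the inverse root. -/
theorem MultilinearMap.polarization_rootsOfUnity {K E : Type*} [Field K] [AddCommGroup E]
    [Module K E] {d m : ℕ} (G : MultilinearMap K (fun _ : Fin d => E) K)
    (hsymm : ∀ (v : Fin d → E) (e : Equiv.Perm (Fin d)), G (fun k => v (e k)) = G v)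
    {ζ ω : K} (hζω : ω * ζ = 1) (hω : ω ^ m = 1) (hω1 : ω ≠ 1) (hω2 : ω * ω ≠ 1)
    (V : Fin d → Bool → E) :
    ∑ s : Fin d → Fin m, (∏ k, ω ^ (s k : ℕ)) *
        G (fun _ => ∑ q : Fin d × Bool, (bif q.2 then ζ else ω) ^ (s q.1 : ℕ) • V q.1 q.2)
      = (m : K) ^ d * d.factorial * G (fun k => V k true) := by
  set u : Bool → K := fun b => bif b then ζ else ω with hu
  have hexp : ∀ s : Fin d → Fin m, (∏ k, ω ^ (s k : ℕ)) *
        G (fun _ => ∑ q : Fin d × Bool, u q.2 ^ (s q.1 : ℕ) • V q.1 q.2)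
      = ∑ r : Fin d → Fin d × Bool, ((∏ k, ω ^ (s k : ℕ)) *
          ∏ j, u (r j).2 ^ (s (r j).1 : ℕ)) * G (fun j => V (r j).1 (r j).2) := by
    intro s
    rw [G.map_sum (fun (_ : Fin d) (q : Fin d × Bool) => u q.2 ^ (s q.1 : ℕ) • V q.1 q.2),
      Finset.mul_sum]
    refine Finset.sum_congr rfl fun r _ => ?_
    rw [G.map_smul_univ (fun j => u (r j).2 ^ (s (r j).1 : ℕ)) (fun j => V (r j).1 (r j).2),
      smul_eq_mul, mul_assoc]
  change ∑ s : Fin d → Fin m, (∏ k, ω ^ (s k : ℕ)) *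
        G (fun _ => ∑ q : Fin d × Bool, u q.2 ^ (s q.1 : ℕ) • V q.1 q.2) = _
  simp_rw [hexp]
  rw [Finset.sum_comm]
  simp_rw [← Finset.sum_mul]
  have hperm : ∑ e : Equiv.Perm (Fin d), (m : K) ^ d * G (fun k => V k true)
      = (m : K) ^ d * d.factorial * G (fun k => V k true) := by
    rw [Finset.sum_const, Finset.card_univ, Fintype.card_perm, Fintype.card_fin, nsmul_eq_mul]
    ring
  rw [← hperm]
  symm
  refine Finset.sum_of_injOn (fun (e : Equiv.Perm (Fin d)) j => (e j, true)) ?_ ?_ ?_ ?_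
  · intro e _ e' _ h
    exact Equiv.ext fun j => (Prod.mk.inj (congrFun h j)).1
  · intro e _
    simp
  · intro r _ hr
    by_cases hsurj : Function.Surjective fun j => (r j).1
    · let e : Equiv.Perm (Fin d) :=
        Equiv.ofBijective _ (Finite.surjective_iff_bijective.mp hsurj)
      have hword := sum_rootsOfUnity_word_of_perm (m := m) ω u e (fun j => (r j).2)
      have hfalse : ∃ j, (r j).2 = false := by
        by_contra! hne
        refine hr ⟨e, by simp, ?_⟩
        funext j
        exact Prod.ext rfl (by simpa using (hne j).symm)
      obtain ⟨j, hj⟩ := hfalse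
      have hzero : ∏ j, ∑ t : Fin m, (ω * u (r j).2) ^ (t : ℕ) = 0 := by
        refine Finset.prod_eq_zero (Finset.mem_univ j) ?_
        rw [hj]
        refine sum_pow_eq_zero_of_pow_eq_one ?_ hω2
        simp [hu, mul_pow, hω]
      rw [hzero] at hword
      exact mul_eq_zero_of_left hword _
    · rw [sum_rootsOfUnity_word_eq_zero_of_not_surjective hω hω1 u r hsurj, zero_mul]
  · intro e _
    rw [sum_rootsOfUnity_word_of_perm ω u e (fun _ => true), hsymm (fun k => V k true) e]
    simp [hu, hζω]

/-- A convex function that is positively homogeneous of degree at least two is nonnegative. -/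
theorem ConvexOn.nonneg_of_homogeneous {E : Type*} [AddCommGroup E] [Module ℝ E] {g : E → ℝ}
    (hg : ConvexOn ℝ Set.univ g) {d : ℕ} (hd : 2 ≤ d)
    (hhom : ∀ (c : ℝ) (x : E), g (c • x) = c ^ d * g x) (x : E) : 0 ≤ g x := by
  have h0 : g 0 = 0 := by
    have h := hhom 0 0
    rwa [smul_zero, zero_pow (by omega), zero_mul] at h
  have h := hg.2 (Set.mem_univ x) (Set.mem_univ 0)
    (show (0 : ℝ) ≤ 1 / 2 by norm_num) (show (0 : ℝ) ≤ 1 / 2 by norm_num) (by norm_num)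
  rw [smul_zero, add_zero, hhom, h0, smul_zero, add_zero, smul_eq_mul] at h
  have hpow : (1 / 2 : ℝ) ^ d ≤ (1 / 2) ^ 2 :=
    pow_le_pow_of_le_one (by norm_num) (by norm_num) hd
  nlinarith



/-- Deterministic core of Theorem 6.3 (convex conjugate form versus its multilinear
relaxation over roots of unity).  `ℂ^{2n}` is encoded as `Fin n ⊕ Fin n → ℂ`; the
general conjugate form of the conjugate super-symmetric multilinear form `G` is
`g x = G((conj x; x),…,(conj x; x))` (always real, written via the real part).  If `g`
is convex, then for any `z^1,…,z^d ∈ Ω_m^{2n}` the maximum of `g` over `Ω_m^n` is at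
least `(d!/(2d)^d)·Re G(z^1,…,z^d)`; "max ≥ bound" is phrased as the existence of a
feasible point attaining the bound. -/
theorem deterministic_core_convex_roots_of_unity
    (n m d : ℕ) (hn : 1 ≤ n) (hm : 3 ≤ m) (hd : 2 ≤ d)
    (G : MultilinearMap ℂ (fun _ : Fin d => (Fin n ⊕ Fin n → ℂ)) ℂ)
    (hsymm : ∀ (v : Fin d → (Fin n ⊕ Fin n → ℂ)) (e : Equiv.Perm (Fin d)),
      G (fun k => v (e k)) = G v)
    (hconj : ∀ v : Fin d → (Fin n ⊕ Fin n → ℂ),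
      G (fun k => fun j => starRingEnd ℂ (v k (Sum.swap j))) = starRingEnd ℂ (G v))
    (hconv : ConvexOn ℝ Set.univ (fun x : Fin n → ℂ =>
      (G (fun _ => Sum.elim (fun j => starRingEnd ℂ (x j)) x)).re))
    (z : Fin d → (Fin n ⊕ Fin n → ℂ)) (hz : ∀ k j, (z k j) ^ m = 1) :
    ∃ x : Fin n → ℂ, (∀ i, (x i) ^ m = 1) ∧
      ((d.factorial : ℝ) / (2 * d) ^ d) * (G z).re
        ≤ (G (fun _ => Sum.elim (fun j => starRingEnd ℂ (x j)) x)).re := by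
  set L : (Fin n → ℂ) → (Fin n ⊕ Fin n → ℂ) :=
    fun x => Sum.elim (fun j => starRingEnd ℂ (x j)) x with hL
  set g : (Fin n → ℂ) → ℝ := fun x => (G (fun _ => L x)).re with hg
  change ConvexOn ℝ Set.univ g at hconv
  have hreal : ∀ x, G (fun _ => L x) = (g x : ℂ) := by
    intro x
    have hfix : (fun j => starRingEnd ℂ (L x (Sum.swap j))) = L x := by
      funext j
      rcases j with j | j <;> simp [hL]
    have h := hconj (fun _ => L x)
    rw [hfix] at h
    exact (Complex.conj_eq_iff_re.mp h.symm).symm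
  have hhom : ∀ (c : ℝ) (x : Fin n → ℂ), g (c • x) = c ^ d * g x := by
    intro c x
    have hLc : L (c • x) = (c : ℂ) • L x := by
      funext j
      rcases j with j | j <;> simp [hL]
    have h := G.map_smul_univ (fun _ => (c : ℂ)) (fun _ => L x)
    rw [Finset.prod_const, Finset.card_univ, Fintype.card_fin, hreal x, ← hLc, hreal,
      smul_eq_mul] at h
    exact_mod_cast h
  have hnonneg := hconv.nonneg_of_homogeneous hd hhom
  obtain ⟨ζ, hζ⟩ : ∃ ζ : ℂ, IsPrimitiveRoot ζ m :=
    ⟨_, Complex.isPrimitiveRoot_exp m (by omega)⟩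
  have hnorm : ‖ζ‖ = 1 := Complex.norm_eq_one_of_pow_eq_one hζ.pow_eq_one (by omega)
  set ω : ℂ := starRingEnd ℂ ζ with hω
  have hωζ : ω * ζ = 1 := by
    rw [hω, mul_comm, Complex.mul_conj, Complex.normSq_eq_norm_sq, hnorm]
    norm_num
  have hωinv : ω = ζ⁻¹ := eq_inv_of_mul_eq_one_left hωζ
  have hωprim : IsPrimitiveRoot ω m := hωinv ▸ hζ.inv
  have hω1 : ω ≠ 1 := hωprim.ne_one (by omega)
  have hω2 : ω * ω ≠ 1 := by
    rw [← pow_two]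
    exact hωprim.pow_ne_one_of_pos_of_lt (by norm_num) (by omega)
  set u : Bool → ℂ := fun b => bif b then ζ else ω with hu
  have hum : ∀ b, u b ^ m = 1 := by
    rintro (_ | _)
    · exact hωprim.pow_eq_one
    · exact hζ.pow_eq_one
  let y : Fin d → Bool → Fin n → ℂ := fun k b j =>
    bif b then z k (Sum.inr j) else starRingEnd ℂ (z k (Sum.inl j))
  let V : Fin d → Bool → (Fin n ⊕ Fin n → ℂ) := fun k b j =>
    bif b then z k j else starRingEnd ℂ (z k (Sum.swap j))
  let p : (Fin d → Fin m) → Fin d × Bool → Fin n → ℂ := fun s q =>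
    u q.2 ^ (s q.1 : ℕ) • y q.1 q.2
  have hp : ∀ s q i, p s q i ^ m = 1 := by
    intro s q i
    have hy : y q.1 q.2 i ^ m = 1 := by
      rcases q with ⟨k, _ | _⟩
      · simp [y, ← map_pow, hz]
      · simp [y, hz]
    simp only [p, Pi.smul_apply, smul_eq_mul, mul_pow, hy, mul_one]
    rw [← pow_mul, mul_comm, pow_mul, hum, one_pow]
  have hLp : ∀ s, L (∑ q, p s q) = ∑ q : Fin d × Bool, u q.2 ^ (s q.1 : ℕ) • V q.1 q.2 := by
    intro s
    funext j
    rcases j with j | j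
    · simp [hL, p, V, y, hu, hω, Fintype.sum_prod_type, add_comm]
    · simp [hL, p, V, y, hu, Fintype.sum_prod_type]
  have hpol := G.polarization_rootsOfUnity hsymm hωζ hωprim.pow_eq_one hω1 hω2 V
  change ∑ s : Fin d → Fin m, (∏ k, ω ^ (s k : ℕ)) *
    G (fun _ => ∑ q : Fin d × Bool, u q.2 ^ (s q.1 : ℕ) • V q.1 q.2)
      = (m : ℂ) ^ d * d.factorial * G z at hpol
  simp_rw [← hLp, hreal] at hpol
  have hre := congrArg Complex.re hpol
  have hcoeff : (m : ℂ) ^ d * d.factorial = (((m : ℝ) ^ d * d.factorial : ℝ) : ℂ) := by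
    push_cast
    rfl
  rw [Complex.re_sum, hcoeff, Complex.re_ofReal_mul] at hre
  have hbound : ∀ s : Fin d → Fin m,
      ((∏ k, ω ^ (s k : ℕ)) * (g (∑ q, p s q) : ℂ)).re ≤ g (∑ q, p s q) := by
    intro s
    rw [Complex.re_mul_ofReal]
    refine mul_le_of_le_one_left (hnonneg _) ((Complex.re_le_norm _).trans ?_)
    simp [hω, hnorm]
  have : Nonempty (Fin m) := ⟨⟨0, by omega⟩⟩
  obtain ⟨s, -, hs⟩ : ∃ s ∈ (Finset.univ : Finset (Fin d → Fin m)),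
      (d.factorial : ℝ) * (G z).re ≤ g (∑ q, p s q) := by
    refine Finset.exists_le_of_sum_le Finset.univ_nonempty ?_
    refine le_trans (le_of_eq ?_) (Finset.sum_le_sum fun s _ => hbound s)
    rw [hre]
    simp [mul_assoc]
  have hd0 : (0 : ℝ) < 2 * d := by
    have : (0 : ℝ) < d := by exact_mod_cast (by omega : 0 < d)
    positivity
  have hcard : ∑ _q : Fin d × Bool, (1 : ℝ) = 2 * d := by
    simp [mul_comm]
  obtain ⟨q, -, hq⟩ := hconv.exists_ge_of_centerMass (t := Finset.univ)
    (w := fun _ : Fin d × Bool => (1 : ℝ)) (p := p s) (fun _ _ => zero_le_one)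
    (by rw [hcard]; exact hd0) (fun _ _ => Set.mem_univ _)
  refine ⟨p s q, hp s q, le_trans ?_ hq⟩
  simp only [Finset.centerMass, hcard, one_smul]
  rw [hhom, inv_pow, div_mul_eq_mul_div, div_eq_inv_mul]
  gcongr
end

section
/- Deterministic core of Theorem 6.4(i) (square-free conjugate form: spread versus the multilinear relaxation over roots of unity): Let m ≥ 3 be an integer, let d ≥ 1, let G : (ℂ^{2n})^d → ℂ be a conjugate super-symmetric ℂ-multilinear form whose associated general conjugate form g : ℂ^n → ℝ is square-free. Then for all z^1, …, z^d ∈ Ω_m^{2n} (vectors in ℂ^{2n} with all entries m-th roots of unity), max{ g(x) : x ∈ Ω_m^n } − min{ g(x) : x ∈ Ω_m^n } ≥ (3/2) · (d! / (2d)^d) · Re G(z^1, …, z^d). -/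
open scoped BigOperators

theorem sum_pow_fin_eq_zero {m : ℕ} {x : ℂ} (hx : x ^ m = 1) (hne : x ≠ 1) :
    ∑ t : Fin m, x ^ (t : ℕ) = 0 := by
  rw [Fin.sum_univ_eq_sum_range (fun t => x ^ t)]
  have h := mul_neg_geom_sum x m
  rw [hx, sub_self] at h
  exact (mul_eq_zero.mp h).resolve_left (sub_ne_zero.mpr hne.symm)

/-- Summing monomials in independent roots of unity factors over the variables. -/
theorem sum_prod_pow_eq {ι : Type*} [Fintype ι] [DecidableEq ι] (m : ℕ) (b : ι → ℂ) :
    ∑ s : ι → Fin m, ∏ k, b k ^ (s k : ℕ) = ∏ k, ∑ t : Fin m, b k ^ (t : ℕ) := by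
  rw [Finset.prod_univ_sum, Fintype.piFinset_univ]

/-- Polarization of a symmetric multilinear form by independent `m`-th roots of unity, for
arguments perturbed by terms carrying the inverse roots. -/
theorem MultilinearMap.sum_roots_polarization {V : Type*} [AddCommGroup V] [Module ℂ V]
    {d m : ℕ} (hm : 3 ≤ m) {ζ : ℂ} (hζ : IsPrimitiveRoot ζ m)
    (G : MultilinearMap ℂ (fun _ : Fin d => V) ℂ)
    (hsymm : ∀ (v : Fin d → V) (e : Equiv.Perm (Fin d)), G (fun k => v (e k)) = G v)
    (z w : Fin d → V) :
    ∑ s : Fin d → Fin m, (∏ k, ζ⁻¹ ^ (s k : ℕ)) *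
        G (fun _ => ∑ k, (ζ ^ (s k : ℕ) • z k + ζ⁻¹ ^ (s k : ℕ) • w k))
      = (m : ℂ) ^ d * d.factorial * G z := by
  have hζ0 : ζ ≠ 0 := hζ.ne_zero (by omega)
  have hinv1 : ζ⁻¹ ≠ 1 := hζ.inv.ne_one (by omega)
  have hinv2 : ζ⁻¹ * ζ⁻¹ ≠ 1 := by
    rw [← pow_two]
    exact hζ.inv.pow_ne_one_of_pos_of_lt (by norm_num) (by omega)
  let ε : Bool → ℂ := fun b => cond b ζ ζ⁻¹
  let v : Fin d × Bool → V := fun p => cond p.2 (z p.1) (w p.1)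
  have hε : ∀ b, ε b ^ m = 1 := by
    rintro (_ | _)
    · exact hζ.inv.pow_eq_one
    · exact hζ.pow_eq_one
  let base : (Fin d → Fin d × Bool) → Fin d → ℂ :=
    fun r k => ζ⁻¹ * ∏ j with (r j).1 = k, ε (r j).2
  have hbase : ∀ r k, base r k ^ m = 1 := by
    intro r k
    simp only [base, mul_pow, hζ.inv.pow_eq_one, ← Finset.prod_pow, hε, Finset.prod_const_one,
      mul_one]
  have hexp : ∀ s : Fin d → Fin m, (∏ k, ζ⁻¹ ^ (s k : ℕ)) *
      G (fun _ => ∑ k, (ζ ^ (s k : ℕ) • z k + ζ⁻¹ ^ (s k : ℕ) • w k))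
      = ∑ r : Fin d → Fin d × Bool, (∏ k, base r k ^ (s k : ℕ)) * G (fun j => v (r j)) := by
    intro s
    have h1 : (∑ k, (ζ ^ (s k : ℕ) • z k + ζ⁻¹ ^ (s k : ℕ) • w k))
        = ∑ p : Fin d × Bool, ε p.2 ^ (s p.1 : ℕ) • v p := by
      rw [Fintype.sum_prod_type]
      simp [ε, v]
    rw [h1, MultilinearMap.map_sum, Finset.mul_sum]
    refine Finset.sum_congr rfl fun r _ => ?_
    rw [MultilinearMap.map_smul_univ, smul_eq_mul, ← mul_assoc]
    congr 1
    rw [← Finset.prod_fiberwise Finset.univ (fun j => (r j).1)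
      (fun j => ε (r j).2 ^ (s (r j).1 : ℕ)), ← Finset.prod_mul_distrib]
    refine Finset.prod_congr rfl fun k _ => ?_
    simp only [base, mul_pow, ← Finset.prod_pow]
    congr 1
    refine Finset.prod_congr rfl fun j hj => ?_
    rw [(Finset.mem_filter.mp hj).2]
  simp_rw [hexp]
  rw [Finset.sum_comm]
  simp_rw [← Finset.sum_mul, sum_prod_pow_eq]
  rw [← Fintype.sum_of_injective
    (fun (e : Equiv.Perm (Fin d)) (j : Fin d) => ((e j, true) : Fin d × Bool))
    (fun e e' h => Equiv.ext fun j => congrArg Prod.fst (congrFun h j))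
    (fun _ => (m : ℂ) ^ d * G z)]
  · simp [Fintype.card_perm]
    ring
  · intro r hr
    suffices h : ∃ k, base r k ≠ 1 by
      obtain ⟨k, hk⟩ := h
      rw [Finset.prod_eq_zero (Finset.mem_univ k) (sum_pow_fin_eq_zero (hbase r k) hk), zero_mul]
    by_contra! hall
    have hsurj : Function.Surjective (fun j => (r j).1) := by
      intro k
      by_contra! hk
      apply hinv1
      rw [← hall k]
      simp only [base]
      rw [Finset.filter_false_of_mem (fun j _ => hk j), Finset.prod_empty, mul_one]
    have hbij := Finite.injective_iff_bijective.mp (Finite.injective_iff_surjective.mpr hsurj)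
    refine hr ⟨Equiv.ofBijective _ hbij, funext fun j => Prod.ext rfl ?_⟩
    by_contra hj
    have hj' : (r j).2 = false := by simpa using Ne.symm hj
    apply hinv2
    rw [← hall (r j).1]
    simp only [base]
    have : (Finset.univ.filter fun i => (r i).1 = (r j).1) = {j} := by
      ext i
      simpa using hbij.1.eq_iff (a := i) (b := j)
    rw [this, Finset.prod_singleton, hj']
    rfl
  · intro e
    have hb : ∀ k, base (fun j => (e j, true)) k = 1 := by
      intro k
      simp only [base, ε, cond_true]
      have : (Finset.univ.filter fun i => e i = k) = {e.symm k} := by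
        ext i
        simp [Equiv.eq_symm_apply]
      rw [this, Finset.prod_singleton, inv_mul_cancel₀ hζ0]
    simp only [hb, one_pow, v, cond_true, hsymm z e]
    simp

/-- A function on `ℂ^ι` that is real-affine in each coordinate is dominated, at a point of the
product of convex hulls, by its value at some point of the product set. -/
theorem exists_ge_of_forall_affine {ι : Type*} [Finite ι] [DecidableEq ι] {S : Set ℂ}
    {f : (ι → ℂ) → ℝ}
    (hf : ∀ (i : ι) (x : ι → ℂ), ∃ (L : ℂ →ₗ[ℝ] ℝ) (c : ℝ), ∀ w,
      f (Function.update x i w) = L w + c)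
    {x : ι → ℂ} (hx : ∀ i, x i ∈ convexHull ℝ S) :
    ∃ y : ι → ℂ, (∀ i, y i ∈ S) ∧ f x ≤ f y := by
  have := Fintype.ofFinite ι
  suffices h : ∀ T : Finset ι, ∃ y : ι → ℂ,
      (∀ i ∈ T, y i ∈ S) ∧ (∀ i ∉ T, y i = x i) ∧ f x ≤ f y by
    obtain ⟨y, hy, -, hle⟩ := h Finset.univ
    exact ⟨y, fun i => hy i (Finset.mem_univ i), hle⟩
  intro T
  induction T using Finset.induction_on with
  | empty => exact ⟨x, by simp, by simp, le_rfl⟩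
  | insert i T hi ih =>
    obtain ⟨y, hyS, hyx, hle⟩ := ih
    obtain ⟨L, c, hL⟩ := hf i y
    have hconv : ConvexOn ℝ (convexHull ℝ S) (fun w => L w + c) :=
      (L.convexOn (convex_convexHull ℝ S)).add_const c
    obtain ⟨w, hwS, hw⟩ := hconv.exists_ge_of_mem_convexHull (subset_convexHull ℝ S)
      (hyx i hi ▸ hx i)
    refine ⟨Function.update y i w, fun j hj => ?_, fun j hj => ?_, hle.trans ?_⟩
    · rcases eq_or_ne j i with rfl | hji
      · simpa using hwS
      · simpa [hji] using hyS j ((Finset.mem_insert.mp hj).resolve_left hji)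
    · rw [Finset.mem_insert, not_or] at hj
      simpa [hj.1] using hyx j hj.2
    · have h := hL (y i)
      rw [Function.update_eq_self] at h
      rw [hL w, h]
      exact hw

/-- Deterministic core of Theorem 6.4(i) (square-free conjugate form: spread versus
the multilinear relaxation over roots of unity).  `ℂ^{2n}` is encoded as
`Fin n ⊕ Fin n → ℂ`; the general conjugate form of the conjugate super-symmetric
multilinear form `G` is `g x = G((conj x; x),…,(conj x; x))` (always real, written via
the real part).  If `g` is square-free — in each coordinate separately real-affine —
then for any `z^1,…,z^d ∈ Ω_m^{2n}`,
`max_{Ω_m^n} g − min_{Ω_m^n} g ≥ (3/2)·(d!/(2d)^d)·Re G(z^1,…,z^d)`; the spread bound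
is phrased as the existence of feasible points `x, y` with
`g x − g y` at least the bound. -/
theorem deterministic_core_square_free_roots_of_unity
    (n m d : ℕ) (hn : 1 ≤ n) (hm : 3 ≤ m) (hd : 1 ≤ d)
    (G : MultilinearMap ℂ (fun _ : Fin d => (Fin n ⊕ Fin n → ℂ)) ℂ)
    (hsymm : ∀ (v : Fin d → (Fin n ⊕ Fin n → ℂ)) (e : Equiv.Perm (Fin d)),
      G (fun k => v (e k)) = G v)
    (hconj : ∀ v : Fin d → (Fin n ⊕ Fin n → ℂ),
      G (fun k => fun j => starRingEnd ℂ (v k (Sum.swap j))) = starRingEnd ℂ (G v))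
    (hsf : ∀ (i : Fin n) (x : Fin n → ℂ), ∃ (L : ℂ →ₗ[ℝ] ℝ) (c : ℝ),
      ∀ w : ℂ,
        (G (fun _ => Sum.elim (fun j => starRingEnd ℂ (Function.update x i w j))
            (Function.update x i w))).re = L w + c)
    (z : Fin d → (Fin n ⊕ Fin n → ℂ)) (hz : ∀ k j, (z k j) ^ m = 1) :
    ∃ x y : Fin n → ℂ, (∀ i, (x i) ^ m = 1) ∧ (∀ i, (y i) ^ m = 1) ∧
      (3 / 2) * ((d.factorial : ℝ) / (2 * d) ^ d) * (G z).re
        ≤ (G (fun _ => Sum.elim (fun j => starRingEnd ℂ (x j)) x)).re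
          - (G (fun _ => Sum.elim (fun j => starRingEnd ℂ (y j)) y)).re := by
  have hm0 : m ≠ 0 := by omega
  obtain ⟨ζ, hζ⟩ : ∃ ζ : ℂ, IsPrimitiveRoot ζ m := ⟨_, Complex.isPrimitiveRoot_exp m hm0⟩
  have hconj_root : ∀ w : ℂ, w ^ m = 1 → starRingEnd ℂ w = w⁻¹ := fun w hw =>
    (Complex.inv_eq_conj (Complex.norm_eq_one_of_pow_eq_one hw hm0)).symm
  set S : Set ℂ := {w | w ^ m = 1} with hS
  let pt : (Fin n → ℂ) → (Fin n ⊕ Fin n → ℂ) := fun x => Sum.elim (fun j => starRingEnd ℂ (x j)) x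
  let g : (Fin n → ℂ) → ℝ := fun x => (G (fun _ => pt x)).re
  have hreal : ∀ x, G (fun _ => pt x) = (g x : ℂ) := by
    intro x
    have h := hconj (fun _ => pt x)
    have h' : (fun j => starRingEnd ℂ (pt x (Sum.swap j))) = pt x := by
      funext j
      rcases j with j | j <;> simp [pt]
    rw [h'] at h
    exact (Complex.conj_eq_iff_re.mp h.symm).symm
  have hfin : {y : Fin n → ℂ | ∀ i, y i ∈ S}.Finite := by
    have h : S.Finite := by
      refine (Polynomial.nthRootsFinset m (1 : ℂ)).finite_toSet.subset fun w hw => ?_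
      exact (Polynomial.mem_nthRootsFinset (by omega) 1).mpr hw
    simpa [Set.pi] using Set.Finite.pi (fun _ : Fin n => h)
  have hne : {y : Fin n → ℂ | ∀ i, y i ∈ S}.Nonempty := ⟨fun _ => 1, fun _ => one_pow m⟩
  obtain ⟨M, hMS, hM⟩ : ∃ M : Fin n → ℂ, (∀ i, M i ∈ S) ∧
      ∀ y : Fin n → ℂ, (∀ i, y i ∈ S) → g y ≤ g M :=
    Set.exists_max_image _ g hfin hne
  obtain ⟨N, hNS, hN⟩ : ∃ N : Fin n → ℂ, (∀ i, N i ∈ S) ∧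
      ∀ y : Fin n → ℂ, (∀ i, y i ∈ S) → g N ≤ g y :=
    Set.exists_min_image _ g hfin hne
  have hgM : ∀ x, (∀ i, x i ∈ convexHull ℝ S) → g x ≤ g M := by
    intro x hx
    obtain ⟨y, hy, hle⟩ := exists_ge_of_forall_affine (f := g) hsf hx
    exact hle.trans (hM y hy)
  have hgN : ∀ x, (∀ i, x i ∈ convexHull ℝ S) → g N ≤ g x := by
    intro x hx
    obtain ⟨y, hy, hle⟩ := exists_ge_of_forall_affine (f := fun x => -g x)
      (fun i x => by
        obtain ⟨L, c, h⟩ := hsf i x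
        refine ⟨-L, -c, fun w => ?_⟩
        simp only [g, pt, h w, LinearMap.neg_apply]
        ring) hx
    exact (hN y hy).trans (neg_le_neg_iff.mp hle)
  let ξ : (Fin d → Fin m) → Fin d → ℂ := fun s k => ζ ^ (s k : ℕ)
  have hξ : ∀ s k, ξ s k ^ m = 1 := fun s k => by
    simp only [ξ, ← pow_mul, mul_comm _ m]
    rw [pow_mul, hζ.pow_eq_one, one_pow]
  let x : (Fin d → Fin m) → Fin n → ℂ := fun s i =>
    (2 * d : ℂ)⁻¹ * ∑ k, (ξ s k * z k (Sum.inr i) + (ξ s k)⁻¹ * starRingEnd ℂ (z k (Sum.inl i)))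
  have hd0 : (d : ℝ) ≠ 0 := by positivity
  have hxS : ∀ s i, x s i ∈ convexHull ℝ S := by
    intro s i
    let p : Fin d × Bool → ℂ := fun q => cond q.2 (ξ s q.1 * z q.1 (Sum.inr i))
      ((ξ s q.1)⁻¹ * starRingEnd ℂ (z q.1 (Sum.inl i)))
    have hp : ∀ q, p q ∈ S := by
      rintro ⟨k, _ | _⟩
      · simp [p, hS, mul_pow, hξ, ← map_pow, hz]
      · simp [p, hS, mul_pow, hξ, hz]
    have hsum : x s i = ∑ q : Fin d × Bool, (2 * d : ℝ)⁻¹ • p q := by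
      rw [← Finset.smul_sum, Fintype.sum_prod_type]
      simp [x, p]
    rw [hsum]
    refine (convex_convexHull ℝ S).sum_mem (fun _ _ => by positivity) ?_
      (fun q _ => subset_convexHull ℝ S (hp q))
    simp
    field_simp
  let τ : Fin d → (Fin n ⊕ Fin n → ℂ) := fun k j => starRingEnd ℂ (z k (Sum.swap j))
  have hpt : ∀ s, pt (x s) =
      (2 * d : ℂ)⁻¹ • ∑ k, (ζ ^ (s k : ℕ) • z k + ζ⁻¹ ^ (s k : ℕ) • τ k) := by
    intro s
    have hc : ∀ k, starRingEnd ℂ (ξ s k) = (ξ s k)⁻¹ := fun k => hconj_root _ (hξ s k)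
    funext j
    rcases j with j | j
    · simp only [pt, x, Sum.elim_inl, map_mul, map_inv₀, map_sum, map_add, hc, Complex.conj_conj,
        inv_inv, map_ofNat, map_natCast]
      simp [ξ, τ, Finset.sum_apply, add_comm]
    · simp [pt, x, ξ, τ, Finset.sum_apply]
  let P : (Fin d → Fin m) → ℂ := fun s => ∏ k, ζ⁻¹ ^ (s k : ℕ)
  have hP1 : ∀ s, ‖P s‖ = 1 := by
    intro s
    have : ‖ζ‖ = 1 := Complex.norm_eq_one_of_pow_eq_one hζ.pow_eq_one hm0
    simp [P, this]
  have hP0 : ∑ s, P s = 0 := by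
    simp only [P]
    rw [sum_prod_pow_eq m (fun _ : Fin d => ζ⁻¹)]
    refine Finset.prod_eq_zero (Finset.mem_univ (⟨0, hd⟩ : Fin d)) ?_
    exact sum_pow_fin_eq_zero hζ.inv.pow_eq_one (hζ.inv.ne_one (by omega))
  have hmain : ∑ s, P s * (g (x s) : ℂ)
      = (m : ℂ) ^ d * (((d.factorial : ℝ) / (2 * d) ^ d : ℝ) * G z) := by
    have h := G.sum_roots_polarization hm hζ hsymm z τ
    have h2 : ∀ s, P s * (g (x s) : ℂ) = ((2 * d : ℂ)⁻¹) ^ d * (P s *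
        G (fun _ => ∑ k, (ζ ^ (s k : ℕ) • z k + ζ⁻¹ ^ (s k : ℕ) • τ k))) := by
      intro s
      rw [← hreal, hpt, G.map_smul_univ (fun _ => (2 * d : ℂ)⁻¹)]
      simp only [Finset.prod_const, Finset.card_univ, Fintype.card_fin, smul_eq_mul]
      ring
    simp_rw [h2]
    rw [← Finset.mul_sum, h]
    push_cast
    rw [inv_pow]
    ring
  have hbound : ‖∑ s, P s * (g (x s) : ℂ)‖ ≤ (m : ℝ) ^ d * ((g M - g N) / 2) := by
    have h : ∑ s, P s * (g (x s) : ℂ)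
        = ∑ s, P s * ((g (x s) - (g M + g N) / 2 : ℝ) : ℂ) := by
      push_cast
      simp_rw [mul_sub]
      rw [Finset.sum_sub_distrib, ← Finset.sum_mul, hP0, zero_mul, sub_zero]
    rw [h]
    refine (norm_sum_le_of_le _ (f := fun s => P s * ((g (x s) - (g M + g N) / 2 : ℝ) : ℂ))
      (n := fun _ => (g M - g N) / 2) fun s _ => ?_).trans ?_
    · rw [norm_mul, hP1, one_mul, Complex.norm_real, Real.norm_eq_abs, abs_le]
      have h1 := hgM _ (hxS s)
      have h2 := hgN _ (hxS s)
      constructor <;> linarith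
    · simp
  refine ⟨M, N, hMS, hNS, ?_⟩
  change _ ≤ g M - g N
  have hspread : g N ≤ g M := hM N hNS
  have hmd : (0 : ℝ) < (m : ℝ) ^ d := by positivity
  have h := (Complex.re_le_norm _).trans hbound
  rw [hmain, ← Complex.ofReal_natCast m, ← Complex.ofReal_pow, Complex.re_ofReal_mul,
    Complex.re_ofReal_mul] at h
  have h' := le_of_mul_le_mul_left h hmd
  linarith
end
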